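/- arXiv:hep-th/9612032 — 4 statements merged into one kernel-verified Lean document; each statement's English description precedes it below -/
import Mathlib

section
/- If a and b are weak vertex operators on V, then for every integer n the n-th residue product a·ₙb is well defined (the two defining sums are finite when applied to any fixed vector of V) and a·ₙb is again a weak vertex operator on V. (Lemma 3.1, due to Li and Dong.) -/
/-!
Lemma 3.1 (Li, Dong): the residue products of weak vertex operators are
well defined and are again weak vertex operators.
-/

variable {R V : Type*} [CommRing R] [AddCommGroup V] [Module R V]

/-- A weak vertex operator on `V`: a family `a : ℤ → End_R(V)` (encoding
`a(z) = ∑ₙ aₙ z^{-n-1}`) such that for every `w ∈ V` we have `aₙ w = 0` for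
all sufficiently large `n`. -/
def IsWeakVertexOperator (a : ℤ → Module.End R V) : Prop :=
  ∀ w : V, ∃ N : ℤ, ∀ n : ℤ, N ≤ n → a n w = 0

/-- The `i`-th summand in the defining sum of the `n`-th residue product
`(a·ₙb)ₘ w = ∑_{i=0}^∞ (-1)^i C(n,i) (a_{n-i}(b_{m+i} w) - (-1)^n b_{n+m-i}(a_i w))`,
where `C(n,i) = Ring.choose n i` is the generalized binomial coefficient. -/
noncomputable def resProdTerm (a b : ℤ → Module.End R V) (n m : ℤ) (w : V) (i : ℕ) : V :=
  ((-1 : ℤ) ^ i * Ring.choose n i) •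
    (a (n - i) (b (m + i) w) - (n.negOnePow : ℤ) • b (n + m - i) (a i w))

/-- The `n`-th residue product of two weak vertex operators, applied to a vector. -/
noncomputable def resProd (a b : ℤ → Module.End R V) (n m : ℤ) (w : V) : V :=
  ∑ᶠ i : ℕ, resProdTerm a b n m w i

theorem IsWeakVertexOperator.finite_support_comp_left {b : ℤ → Module.End R V}
    (hb : IsWeakVertexOperator b) (a : ℤ → Module.End R V) (n m : ℤ) (w : V) :
    (Function.support fun i : ℕ => a (n - i) (b (m + i) w)).Finite := by
  obtain ⟨N, hN⟩ := hb w
  refine (Set.finite_lt_nat (N - m).toNat).subset fun i hi => ?_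
  by_contra h
  exact hi (by simp [hN (m + i) (by simp only [Set.mem_ofPred_eq, not_lt] at h; lia)])

theorem IsWeakVertexOperator.finite_support_comp_right {a : ℤ → Module.End R V}
    (ha : IsWeakVertexOperator a) (b : ℤ → Module.End R V) (n m : ℤ) (w : V) :
    (Function.support fun i : ℕ => b (n + m - i) (a i w)).Finite := by
  obtain ⟨N, hN⟩ := ha w
  refine (Set.finite_lt_nat N.toNat).subset fun i hi => ?_
  by_contra h
  exact hi (by simp [hN i (by simp only [Set.mem_ofPred_eq, not_lt] at h; lia)])

theorem resProdTerm_eq_zero {a b : ℤ → Module.End R V} {n m : ℤ} {w : V} {i : ℕ}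
    (h₁ : a (n - i) (b (m + i) w) = 0) (h₂ : b (n + m - i) (a i w) = 0) :
    resProdTerm a b n m w i = 0 := by
  simp [resProdTerm, h₁, h₂]

theorem finite_support_resProdTerm {a b : ℤ → Module.End R V}
    (ha : IsWeakVertexOperator a) (hb : IsWeakVertexOperator b) (n m : ℤ) (w : V) :
    (Function.support (resProdTerm a b n m w)).Finite := by
  refine ((hb.finite_support_comp_left a n m w).union
    (ha.finite_support_comp_right b n m w)).subset fun i hi => ?_
  by_contra h
  simp only [Set.mem_union, Function.mem_support, not_or, not_not] at h
  exact hi (resProdTerm_eq_zero h.1 h.2)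

theorem resProdTerm_add (a b : ℤ → Module.End R V) (n m : ℤ) (v w : V) (i : ℕ) :
    resProdTerm a b n m (v + w) i = resProdTerm a b n m v i + resProdTerm a b n m w i := by
  simp only [resProdTerm, map_add]
  rw [← smul_add, smul_add (n.negOnePow : ℤ), add_sub_add_comm]

theorem resProdTerm_smul (a b : ℤ → Module.End R V) (n m : ℤ) (r : R) (w : V) (i : ℕ) :
    resProdTerm a b n m (r • w) i = r • resProdTerm a b n m w i := by
  simp only [resProdTerm, map_smul]
  rw [smul_comm _ r, ← smul_sub, smul_comm _ r]

/-- The coefficients of the `n`-th residue product as linear endomorphisms. -/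
noncomputable def resProdEnd {a b : ℤ → Module.End R V}
    (ha : IsWeakVertexOperator a) (hb : IsWeakVertexOperator b) (n m : ℤ) : Module.End R V where
  toFun := resProd a b n m
  map_add' v w := by
    simp only [resProd, resProdTerm_add]
    exact finsum_add_distrib (finite_support_resProdTerm ha hb n m v)
      (finite_support_resProdTerm ha hb n m w)
  map_smul' r w := by
    simp only [resProd, resProdTerm_smul, RingHom.id_apply]
    exact (smul_finsum' r (finite_support_resProdTerm ha hb n m w)).symm

theorem exists_forall_resProd_eq_zero {a b : ℤ → Module.End R V}
    (ha : IsWeakVertexOperator a) (hb : IsWeakVertexOperator b) (n : ℤ) (w : V) :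
    ∃ M : ℤ, ∀ m : ℤ, M ≤ m → resProd a b n m w = 0 := by
  obtain ⟨Na, hNa⟩ := ha w
  obtain ⟨Nb, hNb⟩ := hb w
  choose K hK using fun i : ℕ => hb (a i w)
  obtain ⟨B, hB⟩ := ((Finset.range Na.toNat).image fun i : ℕ => K i + i - n).bddAbove
  refine ⟨max Nb B, fun m hm => ?_⟩
  refine finsum_eq_zero_of_forall_eq_zero fun i => resProdTerm_eq_zero ?_ ?_
  · rw [hNb (m + i) (by lia), map_zero]
  · by_cases hi : i < Na.toNat
    · have := hB (Finset.mem_coe.2 (Finset.mem_image_of_mem _ (Finset.mem_range.2 hi)))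
      exact hK i _ (by lia)
    · rw [hNa i (by lia), map_zero]

/-- **Lemma 3.1.** If `a` and `b` are weak vertex operators on `V`, then for every
integer `n` the residue product `a·ₙb` is well defined (both defining sums are
finite on any fixed vector) and is again a weak vertex operator on `V`. -/
theorem resProd_isWeakVertexOperator (a b : ℤ → Module.End R V)
    (ha : IsWeakVertexOperator a) (hb : IsWeakVertexOperator b) (n : ℤ) :
    (∀ m : ℤ, ∀ w : V,
      (Function.support fun i : ℕ => a (n - i) (b (m + i) w)).Finite ∧
      (Function.support fun i : ℕ => b (n + m - i) (a i w)).Finite) ∧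
    ∃ c : ℤ → Module.End R V,
      (∀ m : ℤ, ∀ w : V, c m w = resProd a b n m w) ∧ IsWeakVertexOperator c := by
  exact ⟨fun m w => ⟨hb.finite_support_comp_left a n m w, ha.finite_support_comp_right b n m w⟩,
    resProdEnd ha hb n, fun _ _ => rfl, exists_forall_resProd_eq_zero ha hb n⟩
end

section
/- Multiplication by (z₁-z₂)^N is injective on formal distributions that are lower truncated in z₁: let W be a module over a commutative ring, N ∈ ℕ, and F : ℤ × ℤ → W a family such that (i) there exists r ∈ ℤ with F(p,q) = 0 for all p ≥ r and all q ∈ ℤ, and (ii) for all p, q ∈ ℤ one has ∑_{i=0}^N (-1)^i C(N,i) F(p+N-i, q+i) = 0, where C(N,i) is the binomial coefficient. Then F(p,q) = 0 for all p, q ∈ ℤ. (This is the 'multiply by a power of z and substitute 0' argument used in the proofs of Theorems 5.4 and 6.5.) -/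
/-!
Multiplication by `(z₁-z₂)^N` is injective on formal distributions that are
lower truncated in `z₁` (the "multiply by a power of `z` and substitute `0`"
argument used in the proofs of Theorems 5.4 and 6.5).
-/

/-- Let `F : ℤ × ℤ → W` encode the formal distribution
`f(z₁,z₂) = ∑ F(p,q) z₁^{-p-1} z₂^{-q-1}`.  If the powers of `z₁` occurring in
`f` are bounded below (i.e. `F(p,q) = 0` for all large `p`) and
`(z₁-z₂)^N f(z₁,z₂) = 0` in coefficient form, then `F = 0`. -/
theorem eq_zero_of_truncated_of_pow_sub_smul_eq_zero
    {R W : Type*} [CommRing R] [AddCommGroup W] [Module R W]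
    (N : ℕ) (F : ℤ × ℤ → W)
    (h1 : ∃ r : ℤ, ∀ p q : ℤ, r ≤ p → F (p, q) = 0)
    (h2 : ∀ p q : ℤ,
      ∑ i ∈ Finset.range (N + 1), ((-1 : ℤ) ^ i * (N.choose i : ℤ)) •
        F (p + N - i, q + i) = 0) :
    ∀ p q : ℤ, F (p, q) = 0 := by
  obtain ⟨r, hr⟩ := h1
  have key : ∀ n : ℕ, ∀ p q : ℤ, r - n ≤ p → F (p, q) = 0 := by
    intro n
    induction n with
    | zero => intro p q hp; exact hr p q (by simpa using hp)
    | succ n ih =>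
      intro p q hp
      have h := h2 p (q - N)
      rw [Finset.sum_range_succ, Finset.sum_eq_zero, zero_add, Nat.choose_self, Nat.cast_one,
        mul_one, add_sub_cancel_right, sub_add_cancel] at h
      · rcases neg_one_pow_eq_or ℤ N with hN | hN <;> simpa [hN] using h
      · intro i hi
        have hiN := Finset.mem_range.mp hi
        rw [ih _ _ (by push_cast at hp; omega), smul_zero]
  intro p q
  exact key (r - p).toNat p q (by omega)
end

section
/- Character sum over the weight-4 codewords of H₈ (the computation underlying Theorem 6.1's criterion that ⟨s^α, s^β⟩ = 0 if and only if α+β has even weight): for δ ∈ (ZMod 2)⁸ let S(δ) = ∑_γ (-1)^{⟨δ,γ⟩} ∈ ℤ, the sum ranging over the 14 weight-4 codewords γ of H₈, where (-1)^{⟨δ,γ⟩} is 1 if ⟨δ,γ⟩ = 0 and -1 if ⟨δ,γ⟩ = 1. Then S(δ) = 14 if δ ∈ H₈; S(δ) = -2 if δ ∉ H₈ and δ has even weight; and S(δ) = 0 if δ has odd weight. -/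
/-!
Character sum over the weight-4 codewords of the `[8,4,4]` Hamming code (the
computation underlying Theorem 6.1).
-/

def g1 : Fin 8 → ZMod 2 := ![1, 1, 1, 1, 1, 1, 1, 1]
def g2 : Fin 8 → ZMod 2 := ![0, 0, 0, 0, 1, 1, 1, 1]
def g3 : Fin 8 → ZMod 2 := ![0, 0, 1, 1, 0, 0, 1, 1]
def g4 : Fin 8 → ZMod 2 := ![1, 0, 1, 0, 1, 0, 1, 0]

/-- The `[8,4,4]` Hamming code: the `𝔽₂`-span of the four generating words. -/
def hammingCode : Submodule (ZMod 2) (Fin 8 → ZMod 2) :=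
  Submodule.span (ZMod 2) {g1, g2, g3, g4}

/-- The weight of a binary word: the number of its nonzero coordinates. -/
def wordWeight (x : Fin 8 → ZMod 2) : ℕ :=
  (Finset.univ.filter fun i => x i ≠ 0).card

/-- The standard bilinear form `⟨x,y⟩ = ∑ i, x i * y i` on `(ZMod 2)⁸`. -/
def binForm (x y : Fin 8 → ZMod 2) : ZMod 2 :=
  ∑ i, x i * y i

open scoped Classical in
/-- The character sum `S(δ) = ∑_γ (-1)^{⟨δ,γ⟩}`, the sum ranging over the
weight-4 codewords `γ` of `H₈`. -/
noncomputable def charSum (δ : Fin 8 → ZMod 2) : ℤ :=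
  ∑ γ ∈ Finset.univ.filter
      (fun γ : Fin 8 → ZMod 2 => γ ∈ hammingCode ∧ wordWeight γ = 4),
    (if binForm δ γ = 0 then (1 : ℤ) else -1)

/-- The encoder of the Hamming code attached to the generators `g1, g2, g3, g4`. -/
def hammingEncode (v : ZMod 2 × ZMod 2 × ZMod 2 × ZMod 2) : Fin 8 → ZMod 2 :=
  v.1 • g1 + v.2.1 • g2 + v.2.2.1 • g3 + v.2.2.2 • g4

lemma mem_hammingCode_iff_exists_encode (x : Fin 8 → ZMod 2) :
    x ∈ hammingCode ↔ ∃ v, hammingEncode v = x := by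
  simp only [hammingCode, Submodule.mem_span_insert, Submodule.mem_span_singleton,
    hammingEncode, Prod.exists]
  constructor
  · rintro ⟨a, _, ⟨b, _, ⟨c, _, ⟨d, rfl⟩, rfl⟩, rfl⟩, rfl⟩
    exact ⟨a, b, c, d, by simp only [add_assoc]⟩
  · rintro ⟨a, b, c, d, rfl⟩
    exact ⟨a, _, ⟨b, _, ⟨c, _, ⟨d, rfl⟩, rfl⟩, rfl⟩, by simp only [add_assoc]⟩

lemma hammingEncode_injective : Function.Injective hammingEncode := by
  rintro ⟨a, b, c, d⟩ ⟨a', b', c', d'⟩ h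
  have h0 := congrFun h 0
  have h1 := congrFun h 1
  have h3 := congrFun h 3
  have h5 := congrFun h 5
  simp [hammingEncode, g1, g2, g3, g4] at h0 h1 h3 h5
  subst h1
  simp_all

lemma wordWeight_hammingEncode_eq_four_iff (v : ZMod 2 × ZMod 2 × ZMod 2 × ZMod 2) :
    wordWeight (hammingEncode v) = 4 ↔ v.2 ≠ 0 := by
  revert v
  decide

lemma binForm_hammingEncode (δ : Fin 8 → ZMod 2) (v : ZMod 2 × ZMod 2 × ZMod 2 × ZMod 2) :
    binForm δ (hammingEncode v) =
      v.1 * binForm δ g1 + v.2.1 * binForm δ g2 + v.2.2.1 * binForm δ g3 +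
        v.2.2.2 * binForm δ g4 := by
  simp only [binForm, hammingEncode, Pi.add_apply, Pi.smul_apply, smul_eq_mul, Finset.mul_sum,
    ← Finset.sum_add_distrib]
  exact Finset.sum_congr rfl fun i _ => by ring

lemma natCast_wordWeight (δ : Fin 8 → ZMod 2) : (wordWeight δ : ZMod 2) = binForm δ g1 := by
  have key : ∀ a : ZMod 2, (if a ≠ 0 then 1 else 0) = a := by decide
  have hg1 : ∀ i, g1 i = 1 := by decide
  simp only [wordWeight, Finset.natCast_card_filter, binForm, key, hg1, mul_one]

/-- The Hamming code is self-dual. -/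
lemma mem_hammingCode_iff_binForm_eq_zero (δ : Fin 8 → ZMod 2) :
    δ ∈ hammingCode ↔
      binForm δ g1 = 0 ∧ binForm δ g2 = 0 ∧ binForm δ g3 = 0 ∧ binForm δ g4 = 0 := by
  rw [mem_hammingCode_iff_exists_encode]
  constructor
  · rintro ⟨v, rfl⟩
    revert v
    decide
  · rintro ⟨h1, h2, h3, h4⟩
    refine ⟨(δ 1, δ 1 + δ 5, δ 1 + δ 3, δ 0 + δ 1), ?_⟩
    simp [binForm, Fin.sum_univ_eight, g1, g2, g3, g4] at h1 h2 h3 h4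
    funext i
    fin_cases i <;> simp [hammingEncode, g1, g2, g3, g4] <;> grind

/-- The character sum in terms of the pairings of `δ` with the generators. -/
lemma charSum_eq_sum_encode (δ : Fin 8 → ZMod 2) :
    charSum δ = ∑ v : ZMod 2 × ZMod 2 × ZMod 2 × ZMod 2 with v.2 ≠ 0,
      if v.1 * binForm δ g1 + v.2.1 * binForm δ g2 + v.2.2.1 * binForm δ g3 +
        v.2.2.2 * binForm δ g4 = 0 then (1 : ℤ) else -1 := by
  symm
  refine Finset.sum_bij (fun v _ => hammingEncode v) ?_
    (fun _ _ _ _ h => hammingEncode_injective h) ?_ ?_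
  · intro v hv
    simp only [Finset.mem_filter, Finset.mem_univ, true_and] at hv ⊢
    exact ⟨(mem_hammingCode_iff_exists_encode _).2 ⟨v, rfl⟩,
      (wordWeight_hammingEncode_eq_four_iff v).2 hv⟩
  · intro γ hγ
    simp only [Finset.mem_filter, Finset.mem_univ, true_and] at hγ
    obtain ⟨v, rfl⟩ := (mem_hammingCode_iff_exists_encode γ).1 hγ.1
    exact ⟨v, by simpa using (wordWeight_hammingEncode_eq_four_iff v).1 hγ.2, rfl⟩
  · intro v _
    simp only [binForm_hammingEncode]

/-- `S(δ) = 14` if `δ ∈ H₈`; `S(δ) = -2` if `δ ∉ H₈` and `δ` has even weight;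
and `S(δ) = 0` if `δ` has odd weight. -/
theorem hammingCode_charSum (δ : Fin 8 → ZMod 2) :
    (δ ∈ hammingCode → charSum δ = 14) ∧
    (δ ∉ hammingCode → Even (wordWeight δ) → charSum δ = -2) ∧
    (Odd (wordWeight δ) → charSum δ = 0) := by
  have key : ∀ a b c d : ZMod 2,
      ∀ S : ℤ, S = (∑ v : ZMod 2 × ZMod 2 × ZMod 2 × ZMod 2 with v.2 ≠ 0,
        if v.1 * a + v.2.1 * b + v.2.2.1 * c + v.2.2.2 * d = 0 then (1 : ℤ) else -1) →
      (a = 0 ∧ b = 0 ∧ c = 0 ∧ d = 0 → S = 14) ∧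
      (¬ (a = 0 ∧ b = 0 ∧ c = 0 ∧ d = 0) → a = 0 → S = -2) ∧ (a ≠ 0 → S = 0) := by
    simp only [forall_eq]
    decide
  rw [← ZMod.natCast_eq_zero_iff_even, ← Nat.not_even_iff_odd, ← ZMod.natCast_eq_zero_iff_even,
    natCast_wordWeight, mem_hammingCode_iff_binForm_eq_zero]
  exact key _ _ _ _ _ (charSum_eq_sum_encode δ)
end

section
/- Uniqueness of the self-dual doubly even code of length 8: every binary linear code C ⊆ (ZMod 2)⁸ that is self-dual (C = C^⊥ with respect to the standard bilinear form) and doubly even (the weight of every codeword of C is divisible by 4) is a coordinate permutation of the [8,4,4] Hamming code: there exists a permutation σ of the 8 coordinates with C = {x∘σ : x ∈ H₈}. (Fact used in Section 6.1: 'the [8,4,4]-Hamming code is the only self-dual doubly even code of length 8'.) -/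
/-- The sign character `(-1)^a` of a bit `a`. -/
def bitSign (a : ZMod 2) : ℤ := if a = 0 then 1 else -1

lemma bitSign_add (a b : ZMod 2) : bitSign (a + b) = bitSign a * bitSign b := by
  decide +revert

lemma bitSign_mul_self (a : ZMod 2) : bitSign a * bitSign a = 1 := by
  decide +revert

lemma bitSign_mul_nonneg (a b : ZMod 2) : 0 ≤ 1 + bitSign a * bitSign b := by
  decide +revert

lemma sum_bitSign (x : Fin 8 → ZMod 2) : ∑ i, bitSign (x i) = 8 - 2 * (wordWeight x : ℤ) := by
  have h : ∀ i, bitSign (x i) = 1 - 2 * (if x i ≠ 0 then 1 else 0) := by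
    intro i
    unfold bitSign
    split_ifs <;> simp_all
  simp only [h, Finset.sum_sub_distrib, ← Finset.mul_sum, Finset.sum_boole, wordWeight]
  simp

lemma sum_bitSign_eq_zero {x : Fin 8 → ZMod 2} (hx : 4 ∣ wordWeight x) {i j : Fin 8}
    (hij : x i ≠ x j) : ∑ k, bitSign (x k) = 0 := by
  have hle : wordWeight x ≤ 8 := Finset.card_le_univ _
  have h0 : wordWeight x ≠ 0 := by
    intro h
    simp only [wordWeight, Finset.card_eq_zero, Finset.filter_eq_empty_iff, Finset.mem_univ,
      true_implies, not_not] at h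
    exact hij (by rw [h, h])
  have h8 : wordWeight x ≠ 8 := by
    intro h
    have hu : (Finset.univ.filter fun i => x i ≠ 0) = Finset.univ :=
      Finset.eq_univ_of_card _ h
    simp only [Finset.filter_eq_self, Finset.mem_univ, true_implies] at hu
    have hb : ∀ a b : ZMod 2, a ≠ 0 → b ≠ 0 → a = b := by decide
    exact hij (hb _ _ (hu i) (hu j))
  rw [sum_bitSign]
  omega

/-- Three words all of whose nontrivial sums are balanced take each triple of values only once. -/
lemma injective_of_sum_bitSign_eq_zero {a b c : Fin 8 → ZMod 2}
    (ha : ∑ k, bitSign (a k) = 0) (hb : ∑ k, bitSign (b k) = 0) (hc : ∑ k, bitSign (c k) = 0)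
    (hab : ∑ k, bitSign ((a + b) k) = 0) (hac : ∑ k, bitSign ((a + c) k) = 0)
    (hbc : ∑ k, bitSign ((b + c) k) = 0) (habc : ∑ k, bitSign ((a + b + c) k) = 0) :
    Function.Injective fun i => (a i, b i, c i) := by
  intro i j hij
  simp only [Prod.mk.injEq] at hij
  obtain ⟨h1, h2, h3⟩ := hij
  by_contra hne
  let F : Fin 8 → ℤ := fun k => (1 + bitSign (a i) * bitSign (a k)) *
    (1 + bitSign (b i) * bitSign (b k)) * (1 + bitSign (c i) * bitSign (c k))
  have hF : ∑ k, F k = 8 := by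
    simp only [Pi.add_apply, bitSign_add] at hab hac hbc habc
    have : ∀ k, F k = 1 + bitSign (a i) * bitSign (a k) + bitSign (b i) * bitSign (b k)
        + bitSign (c i) * bitSign (c k)
        + bitSign (a i) * bitSign (b i) * (bitSign (a k) * bitSign (b k))
        + bitSign (a i) * bitSign (c i) * (bitSign (a k) * bitSign (c k))
        + bitSign (b i) * bitSign (c i) * (bitSign (b k) * bitSign (c k))
        + bitSign (a i) * bitSign (b i) * bitSign (c i) *
          (bitSign (a k) * bitSign (b k) * bitSign (c k)) := by
      intro k
      simp only [F]
      ring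
    simp only [this, Finset.sum_add_distrib, ← Finset.mul_sum, ha, hb, hc, hab, hac, hbc, habc]
    simp
  have hFi : F i = 8 := by
    simp only [F, bitSign_mul_self]
    norm_num
  have hFj : F j = 8 := by
    simp only [F, ← h1, ← h2, ← h3, bitSign_mul_self]
    norm_num
  have hle : ∑ k ∈ {i, j}, F k ≤ ∑ k, F k :=
    Finset.sum_le_sum_of_subset_of_nonneg (Finset.subset_univ _) fun k _ _ =>
      mul_nonneg (mul_nonneg (bitSign_mul_nonneg _ _) (bitSign_mul_nonneg _ _))
        (bitSign_mul_nonneg _ _)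
  rw [Finset.sum_pair hne, hF, hFi, hFj] at hle
  norm_num at hle

lemma exists_mem_apply_ne {C : Submodule (ZMod 2) (Fin 8 → ZMod 2)}
    (hsd : ∀ x : Fin 8 → ZMod 2, (∀ y ∈ C, binForm x y = 0) → x ∈ C)
    (hde : ∀ x ∈ C, 4 ∣ wordWeight x) {i j : Fin 8} (hij : i ≠ j) :
    ∃ x ∈ C, x i ≠ x j := by
  by_contra! h
  have hmem : (Pi.single i 1 + Pi.single j 1 : Fin 8 → ZMod 2) ∈ C := by
    refine hsd _ fun y hy => ?_
    simp only [binForm, Pi.add_apply, add_mul, Finset.sum_add_distrib, Pi.single_apply, ite_mul,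
      one_mul, zero_mul, Finset.sum_ite_eq', Finset.mem_univ, if_true]
    rw [h y hy, CharTwo.add_self_eq_zero]
  have h4 := hde _ hmem
  have h2 : ∀ i j : Fin 8, i ≠ j →
      ¬ 4 ∣ wordWeight (Pi.single i 1 + Pi.single j 1 : Fin 8 → ZMod 2) := by
    decide
  exact h2 i j hij h4

lemma one_mem_of_selfDual {C : Submodule (ZMod 2) (Fin 8 → ZMod 2)}
    (hsd : ∀ x : Fin 8 → ZMod 2, (∀ y ∈ C, binForm x y = 0) → x ∈ C)
    (hde : ∀ x ∈ C, 4 ∣ wordWeight x) : (1 : Fin 8 → ZMod 2) ∈ C := by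
  refine hsd _ fun y hy => ?_
  have h : ∀ a : ZMod 2, a = if a ≠ 0 then 1 else 0 := by decide
  have hsum : binForm 1 y = (wordWeight y : ZMod 2) := by
    simp only [binForm, Pi.one_apply, one_mul, wordWeight]
    rw [← Finset.sum_boole]
    exact Finset.sum_congr rfl fun i _ => h (y i)
  rw [hsum, ZMod.natCast_eq_zero_iff]
  exact (by norm_num : 2 ∣ 4).trans (hde y hy)

lemma mem_hammingCode_of_binForm_eq_zero {x : Fin 8 → ZMod 2} (h1 : binForm x g1 = 0)
    (h2 : binForm x g2 = 0) (h3 : binForm x g3 = 0) (h4 : binForm x g4 = 0) :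
    x ∈ hammingCode := by
  have hx : x = x 1 • g1 + (x 1 + x 5) • g2 + (x 1 + x 3) • g3 + (x 1 + x 0) • g4 := by
    simp only [binForm, g1, g2, g3, g4, Fin.sum_univ_eight] at h1 h2 h3 h4
    simp at h1 h2 h3 h4
    ext i
    fin_cases i <;> simp [g1, g2, g3, g4] <;> grind
  rw [hx]
  have hg : ∀ g ∈ ({g1, g2, g3, g4} : Set (Fin 8 → ZMod 2)), g ∈ hammingCode :=
    fun _ hg => Submodule.subset_span hg
  exact add_mem (add_mem (add_mem (Submodule.smul_mem _ _ (hg _ (by simp)))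
    (Submodule.smul_mem _ _ (hg _ (by simp)))) (Submodule.smul_mem _ _ (hg _ (by simp))))
    (Submodule.smul_mem _ _ (hg _ (by simp)))

lemma exists_perm_generators_comp_eq {a b c : Fin 8 → ZMod 2}
    (h : Function.Injective fun i => (a i, b i, c i)) :
    ∃ σ : Equiv.Perm (Fin 8), g2 ∘ σ = a ∧ g3 ∘ σ = b ∧ g4 ∘ σ = c := by
  have hcard : Fintype.card (Fin 8) = Fintype.card (ZMod 2 × ZMod 2 × ZMod 2) := rfl
  have hg : Function.Injective fun i => (g2 i, g3 i, g4 i) := by decide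
  let e := Equiv.ofBijective _ ((Fintype.bijective_iff_injective_and_card _).2 ⟨h, hcard⟩)
  let e' := Equiv.ofBijective _ ((Fintype.bijective_iff_injective_and_card _).2 ⟨hg, hcard⟩)
  have he : ∀ i, e' (e'.symm (e i)) = e i := fun i => e'.apply_symm_apply _
  refine ⟨e.trans e'.symm, ?_, ?_, ?_⟩ <;> ext1 i
  · exact congrArg (fun p => p.1) (he i)
  · exact congrArg (fun p => p.2.1) (he i)
  · exact congrArg (fun p => p.2.2) (he i)

lemma binForm_comp_symm (σ : Equiv.Perm (Fin 8)) (x y : Fin 8 → ZMod 2) :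
    binForm (x ∘ σ.symm) y = binForm x (y ∘ σ) := by
  simp only [binForm, Function.comp_apply]
  rw [← Equiv.sum_comp σ]
  simp

/-- If `C ⊆ (ZMod 2)⁸` is self-dual (`C = C^⊥`) and doubly even (every codeword
has weight divisible by `4`), then `C` is a coordinate permutation of the
`[8,4,4]` Hamming code: `C = {x ∘ σ : x ∈ H₈}` for some permutation `σ`. -/
theorem selfDual_doublyEven_eq_hammingCode
    (C : Submodule (ZMod 2) (Fin 8 → ZMod 2))
    (hsd : ∀ x : Fin 8 → ZMod 2, x ∈ C ↔ ∀ y ∈ C, binForm x y = 0)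
    (hde : ∀ x ∈ C, 4 ∣ wordWeight x) :
    ∃ σ : Equiv.Perm (Fin 8),
      (C : Set (Fin 8 → ZMod 2)) = {y | ∃ x ∈ hammingCode, y = x ∘ σ} := by
  have hsd' := fun x => (hsd x).2
  obtain ⟨a, haC, ha⟩ := exists_mem_apply_ne hsd' hde (zero_ne_one : (0 : Fin 8) ≠ 1)
  obtain ⟨i, j, hij, haij⟩ := Fintype.exists_ne_map_eq_of_card_lt a (by decide)
  obtain ⟨b, hbC, hb⟩ := exists_mem_apply_ne hsd' hde hij
  obtain ⟨k, l, hkl, habkl⟩ :=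
    Fintype.exists_ne_map_eq_of_card_lt (fun i => (a i, b i)) (by decide)
  simp only [Prod.mk.injEq] at habkl
  obtain ⟨hakl, hbkl⟩ := habkl
  obtain ⟨c, hcC, hc⟩ := exists_mem_apply_ne hsd' hde hkl
  have habC := add_mem haC hbC
  obtain ⟨σ, rfl, rfl, rfl⟩ := exists_perm_generators_comp_eq <|
    injective_of_sum_bitSign_eq_zero
      (sum_bitSign_eq_zero (hde _ haC) ha)
      (sum_bitSign_eq_zero (hde _ hbC) hb)
      (sum_bitSign_eq_zero (hde _ hcC) hc)
      (sum_bitSign_eq_zero (hde _ habC) (i := i) (j := j) (by simpa [haij] using hb))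
      (sum_bitSign_eq_zero (hde _ (add_mem haC hcC)) (i := k) (j := l)
        (by simpa [hakl] using hc))
      (sum_bitSign_eq_zero (hde _ (add_mem hbC hcC)) (i := k) (j := l)
        (by simpa [hbkl] using hc))
      (sum_bitSign_eq_zero (hde _ (add_mem habC hcC)) (i := k) (j := l)
        (by simpa [hakl, hbkl] using hc))
  have h1C : g1 ∘ σ ∈ C := by
    have h1 : g1 = 1 := by decide
    rw [h1]
    exact one_mem_of_selfDual hsd' hde
  refine ⟨σ, Set.ext fun y => ⟨fun hy => ⟨y ∘ σ.symm, ?_, ?_⟩, ?_⟩⟩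
  · have horth := (hsd y).1 hy
    apply mem_hammingCode_of_binForm_eq_zero <;> rw [binForm_comp_symm] <;> apply horth <;>
      assumption
  · ext1 m
    simp
  · rintro ⟨x, hx, rfl⟩
    have hle : hammingCode ≤ C.comap (LinearMap.funLeft (ZMod 2) (ZMod 2) σ) := by
      refine Submodule.span_le.2 ?_
      rintro g (rfl | rfl | rfl | rfl) <;> assumption
    exact hle hx
end
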